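/- Let n ≥ 1 and let p₀, p₁, …, p_{n+1} be points of ℝⁿ × ℝ. There exists a map f(x, t) = (A x + t·b + c, t), with A an invertible n × n real matrix and b, c ∈ ℝⁿ (i.e., an element of the group (𝒜ᶜ_st, Id_t), whose temporal component is the identity), such that f(q_j) = p_j for all 0 ≤ j ≤ n+1, where (q₀, …, q_{n+1}) is the standard coordinate system of ℝⁿ × ℝ, if and only if: (i) the n+2 points p₀, …, p_{n+1} are affinely independent in ℝⁿ × ℝ ≅ ℝ^{n+1}; (ii) the points p₀, p₁, …, pₙ all have temporal coordinate 0; and (iii) the point p_{n+1} has temporal coordinate 1. -/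

import Mathlib

/-- The standard coordinate system `(q₀, q₁, …, qₙ, q_{n+1})` of `ℝⁿ × ℝ`:
`q₀ = (0,0)`, `qᵢ = (eᵢ, 0)` for `1 ≤ i ≤ n`, and `q_{n+1} = (0,1)`. -/
noncomputable def stdCoordSys (n : ℕ) : Fin (n + 2) → EuclideanSpace ℝ (Fin n) × ℝ :=
  fun j =>
    if _ : (j : ℕ) = 0 then (0, 0)
    else if h' : (j : ℕ) ≤ n then
      (EuclideanSpace.single (⟨(j : ℕ) - 1, by omega⟩ : Fin n) 1, 0)
    else (0, 1)

theorem stdCoordSys_zero (n : ℕ) : stdCoordSys n 0 = (0, 0) := by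
  simp [stdCoordSys]

theorem stdCoordSys_succ_castSucc {n : ℕ} (i : Fin n) :
    stdCoordSys n i.castSucc.succ = (EuclideanSpace.single i 1, 0) := by
  simp [stdCoordSys]

theorem stdCoordSys_last (n : ℕ) : stdCoordSys n (Fin.last (n + 1)) = (0, 1) := by
  simp [stdCoordSys]

/-- A property of all indices in `Fin (n + 2)` splits into the first index, the middle ones, and
the last one. -/
theorem Fin.forall_iff_zero_succ_castSucc_last {n : ℕ} {P : Fin (n + 2) → Prop} :
    (∀ j, P j) ↔ P 0 ∧ (∀ i : Fin n, P i.castSucc.succ) ∧ P (Fin.last (n + 1)) := by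
  rw [Fin.forall_fin_succ, Fin.forall_fin_succ', Fin.succ_last]

/-- If all points but the last lie in the slice `V × {0}` and the last one does not, affine
independence reduces to linear independence of the differences in `V`. -/
theorem affineIndependent_prod_iff_linearIndependent {V : Type*} [AddCommGroup V] [Module ℝ V]
    {n : ℕ} {p : Fin (n + 2) → V × ℝ} (h0 : (p 0).2 = 0)
    (hmid : ∀ i : Fin n, (p i.castSucc.succ).2 = 0) (hlast : (p (Fin.last (n + 1))).2 ≠ 0) :
    AffineIndependent ℝ p ↔
      LinearIndependent ℝ fun i : Fin n => (p i.castSucc.succ).1 - (p 0).1 := by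
  have hinit : (fun i : Fin n => p i.castSucc.succ - p 0) =
      LinearMap.inl ℝ V ℝ ∘ fun i : Fin n => (p i.castSucc.succ).1 - (p 0).1 := by
    ext i <;> simp [h0, hmid]
  have hsnoc : (fun i : Fin (n + 1) => p i.succ - p 0) =
      Fin.snoc (fun i : Fin n => p i.castSucc.succ - p 0) (p (Fin.last (n + 1)) - p 0) := by
    funext i
    refine Fin.lastCases ?_ (fun i => ?_) i <;> simp
  have hspan : p (Fin.last (n + 1)) - p 0 ∉
      Submodule.span ℝ (Set.range fun i : Fin n => p i.castSucc.succ - p 0) := by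
    intro hmem
    have hle : Submodule.span ℝ (Set.range fun i : Fin n => p i.castSucc.succ - p 0) ≤
        LinearMap.ker (LinearMap.snd ℝ V ℝ) := by
      rw [Submodule.span_le]
      rintro _ ⟨i, rfl⟩
      simp [h0, hmid]
    exact hlast (by simpa [h0] using hle hmem)
  rw [affineIndependent_iff_linearIndependent_vsub ℝ p 0,
    ← linearIndependent_equiv (finSuccAboveEquiv (0 : Fin (n + 2)))]
  change LinearIndependent ℝ (fun i : Fin (n + 1) => p ((0 : Fin (n + 2)).succAbove i) - p 0) ↔ _
  simp only [Fin.zero_succAbove]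
  rw [hsnoc, linearIndependent_finSnoc, and_iff_left hspan, hinit,
    LinearMap.linearIndependent_iff _ (LinearMap.ker_eq_bot.2 LinearMap.inl_injective)]

theorem Matrix.isUnit_iff_linearIndependent_toEuclideanLin_single {n : ℕ}
    (A : Matrix (Fin n) (Fin n) ℝ) :
    IsUnit A ↔
      LinearIndependent ℝ fun i => Matrix.toEuclideanLin A (EuclideanSpace.single i 1) := by
  rw [← Matrix.linearIndependent_cols_iff_isUnit, ← LinearMap.linearIndependent_iff
    (WithLp.linearEquiv 2 ℝ (Fin n → ℝ)).toLinearMap (LinearEquiv.ker _)]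
  congr! 1
  ext i j
  simp [Matrix.toLpLin_apply, Matrix.col]

/-- `(p₀, …, p_{n+1})` is the image of the standard coordinate system of
`ℝⁿ × ℝ` under an element of `(𝒜ᶜ_st, Id_t)` iff the points are affinely independent,
`p₀, …, pₙ` all have temporal coordinate `0`, and `p_{n+1}` has temporal coordinate `1`. -/
theorem image_stdCoordSys_timeIndependentAffinity_timeIdentity_iff (n : ℕ) (hn : 1 ≤ n)
    (p : Fin (n + 2) → EuclideanSpace ℝ (Fin n) × ℝ) :
    (∃ (A : Matrix (Fin n) (Fin n) ℝ) (b c : EuclideanSpace ℝ (Fin n)),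
        IsUnit A ∧
        ∀ j : Fin (n + 2),
          (Matrix.toEuclideanLin A (stdCoordSys n j).1 + (stdCoordSys n j).2 • b + c,
            (stdCoordSys n j).2) = p j)
      ↔ (AffineIndependent ℝ p ∧
         (∀ j : Fin (n + 2), (j : ℕ) ≤ n → (p j).2 = 0) ∧
         (p (Fin.last (n + 1))).2 = 1) := by
  constructor
  · rintro ⟨A, b, c, hA, hp⟩
    have htime : ∀ j, (p j).2 = (stdCoordSys n j).2 := fun j => by rw [← hp j]
    have h0 : (p 0).2 = 0 := by simp [htime, stdCoordSys_zero]
    have hmid : ∀ i : Fin n, (p i.castSucc.succ).2 = 0 := fun i => by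
      simp [htime, stdCoordSys_succ_castSucc]
    have hlast : (p (Fin.last (n + 1))).2 = 1 := by rw [htime, stdCoordSys_last]
    refine ⟨?_, ?_, hlast⟩
    · rw [affineIndependent_prod_iff_linearIndependent h0 hmid (by simp [hlast])]
      convert A.isUnit_iff_linearIndependent_toEuclideanLin_single.1 hA using 2 with i
      rw [← hp, ← hp, stdCoordSys_succ_castSucc, stdCoordSys_zero]
      simp
    · exact Fin.forall_iff_zero_succ_castSucc_last.2
        ⟨fun _ => h0, fun i _ => hmid i, fun h => by simp at h⟩
  · rintro ⟨hind, hzero, hlast⟩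
    have h0 : (p 0).2 = 0 := hzero 0 (by simp)
    have hmid : ∀ i : Fin n, (p i.castSucc.succ).2 = 0 := fun i => hzero _ (by simp)
    rw [affineIndependent_prod_iff_linearIndependent h0 hmid (by simp [hlast])] at hind
    let A : Matrix (Fin n) (Fin n) ℝ :=
      Matrix.of fun i j => ((p j.castSucc.succ).1 - (p 0).1) i
    have hA : ∀ i, Matrix.toEuclideanLin A (EuclideanSpace.single i 1) =
        (p i.castSucc.succ).1 - (p 0).1 := fun i => by
      ext j
      simp [A, Matrix.toLpLin_apply]
    refine ⟨A, (p (Fin.last (n + 1))).1 - (p 0).1, (p 0).1,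
      A.isUnit_iff_linearIndependent_toEuclideanLin_single.2 (by simpa only [hA] using hind),
      Fin.forall_iff_zero_succ_castSucc_last.2 ⟨?_, fun i => ?_, ?_⟩⟩
    · simp [stdCoordSys_zero, Prod.ext_iff, h0]
    · simp [stdCoordSys_succ_castSucc, Prod.ext_iff, hA, hmid]
    · simp [stdCoordSys_last, Prod.ext_iff, hlast]
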